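/- arXiv:1206.4165 — 2 statements merged into one kernel-verified Lean document; each statement's English description precedes it below -/
import Mathlib

section
/- Let K be a differential field with derivation ∂ and field of constants C = ker ∂. The solutions in K of a homogeneous linear differential equation a_n u^(n) + ... + a_1 u' + a_0 u = 0 with coefficients a_i ∈ K and a_n ≠ 0 form a C-vector subspace of K of dimension at most n. -/
open Matrix

/-- A subspace of `ι → K` that is nonzero and stable under a derivation of `K` applied
componentwise contains a nonzero vector of constants. -/
theorem Submodule.exists_ne_zero_of_derivation_stable {ι K : Type*} [Finite ι] [Field K]
    (D : Derivation ℤ K K) (V : Submodule K (ι → K)) (hV : V ≠ ⊥)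
    (hD : ∀ c ∈ V, (fun j => D (c j)) ∈ V) :
    ∃ c ∈ V, c ≠ 0 ∧ ∀ j, D (c j) = 0 := by
  obtain ⟨c₀, hc₀, hc₀'⟩ := V.exists_mem_ne_zero_of_ne_bot hV
  -- a nonzero vector of minimal support, normalized to have an entry `1`
  obtain ⟨b, ⟨hb, hb0⟩, hmin⟩ := exists_minimalFor_of_wellFoundedLT
    (fun c : ι → K => c ∈ V ∧ c ≠ 0) (fun c => (Function.support c).ncard) ⟨c₀, hc₀, hc₀'⟩
  obtain ⟨k, hk⟩ := Function.ne_iff.mp hb0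
  have hk : b k ≠ 0 := hk
  refine ⟨(b k)⁻¹ • b, V.smul_mem _ hb, smul_ne_zero (inv_ne_zero hk) hb0, ?_⟩
  by_contra! h
  have hlt : (Function.support fun j => D (((b k)⁻¹ • b) j)).ncard <
      (Function.support b).ncard := by
    refine Set.ncard_lt_ncard ⟨fun j hj hbj => hj ?_, fun hsub => hsub hk ?_⟩
    · simp [hbj]
    · simp [hk]
  refine hlt.not_ge (hmin ⟨hD _ (V.smul_mem _ hb), ?_⟩ hlt.le)
  exact fun h0 => h.elim fun j hj => hj (congrFun h0 j)

theorem Derivation.iterate_map_const_mul {K : Type*} [CommRing K] (D : Derivation ℤ K K)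
    {c : K} (hc : D c = 0) (u : K) (i : ℕ) : D^[i] (c * u) = c * D^[i] u := by
  induction i with
  | zero => rfl
  | succ i ih => simp [Function.iterate_succ_apply', ih, hc]

/-- Any `n + 1` solutions of a homogeneous linear differential equation of order `n` are
linearly dependent over the constants. -/
theorem Derivation.exists_constants_sum_mul_eq_zero {K : Type*} [Field K]
    (D : Derivation ℤ K K) {n : ℕ} (a : Fin (n + 1) → K) (ha : a (Fin.last n) ≠ 0)
    (u : Fin (n + 1) → K) (hu : ∀ j, ∑ i, a i * D^[(i : ℕ)] (u j) = 0) :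
    ∃ c : Fin (n + 1) → K, (∀ j, D (c j) = 0) ∧ c ≠ 0 ∧ ∑ j, c j * u j = 0 := by
  let M : Matrix (Fin (n + 1)) (Fin (n + 1)) K := fun i j => D^[(i : ℕ)] (u j)
  have haM : a ᵥ* M = 0 := funext hu
  have hdet : M.det = 0 :=
    exists_vecMul_eq_zero_iff.mp ⟨a, fun h => ha (congrFun h _), haM⟩
  obtain ⟨v, hv, hMv⟩ := exists_mulVec_eq_zero_iff.mpr hdet
  have hbot : LinearMap.ker M.mulVecLin ≠ ⊥ :=
    (Submodule.ne_bot_iff _).mpr ⟨v, hMv, hv⟩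
  obtain ⟨c, hc, hc0, hDc⟩ :=
    Submodule.exists_ne_zero_of_derivation_stable D _ hbot fun c hc => by
      have hc : M *ᵥ c = 0 := hc
      change M *ᵥ (fun j => D (c j)) = 0
      have hlow (i : Fin n) : (M *ᵥ fun j => D (c j)) i.castSucc = 0 := by
        have h1 : ∑ j, D^[(i : ℕ)] (u j) * c j = 0 := congrFun hc i.castSucc
        have h2 : ∑ j, D^[(i : ℕ) + 1] (u j) * c j = 0 := congrFun hc i.succ
        have h3 := congrArg D h1
        simp only [map_sum, Derivation.leibniz, map_zero, smul_eq_mul, Finset.sum_add_distrib,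
          ← Function.iterate_succ_apply' D] at h3
        simp only [mul_comm (c _)] at h3
        rwa [h2, add_zero] at h3
      -- the last row is a combination of the others by the differential equation
      have hlast : (M *ᵥ fun j => D (c j)) (Fin.last n) = 0 := by
        have h : a ⬝ᵥ (M *ᵥ fun j => D (c j)) = 0 := by
          rw [dotProduct_mulVec, haM, zero_dotProduct]
        rw [dotProduct, Fin.sum_univ_castSucc] at h
        simpa [hlow, ha] using h
      exact funext fun i => Fin.lastCases hlast hlow i
  refine ⟨c, hDc, hc0, ?_⟩
  have h : ∑ j, u j * c j = 0 := congrFun hc 0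
  simpa only [mul_comm] using h


/-- Let K be a differential field with derivation ∂ and field of constants
C = ker ∂. The solutions in K of a homogeneous linear differential equation
a_n u^(n) + ... + a_0 u = 0 with a_n ≠ 0 form a C-vector subspace of K of dimension
at most n (closure under addition and multiplication by constants, and any n+1
solutions are linearly dependent over the constants). -/
theorem stmt_0 (K : Type) [Field K] [CharZero K] (d : K → K)
    (hd_add : ∀ a b : K, d (a + b) = d a + d b)
    (hd_mul : ∀ a b : K, d (a * b) = a * d b + d a * b)
    (n : ℕ) (a : Fin (n + 1) → K) (ha : a (Fin.last n) ≠ 0) :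
    (∀ u v : K, (∑ i, a i * d^[(i : ℕ)] u) = 0 → (∑ i, a i * d^[(i : ℕ)] v) = 0 →
      (∑ i, a i * d^[(i : ℕ)] (u + v)) = 0) ∧
    (∀ c u : K, d c = 0 → (∑ i, a i * d^[(i : ℕ)] u) = 0 →
      (∑ i, a i * d^[(i : ℕ)] (c * u)) = 0) ∧
    (∀ u : Fin (n + 1) → K, (∀ j, (∑ i, a i * d^[(i : ℕ)] (u j)) = 0) →
      ∃ c : Fin (n + 1) → K, (∀ j, d (c j) = 0) ∧ (∃ j, c j ≠ 0) ∧
        (∑ j, c j * u j) = 0) := by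
  obtain ⟨D, rfl⟩ : ∃ D : Derivation ℤ K K, ⇑D = d :=
    ⟨Derivation.mk' (AddMonoidHom.mk' d hd_add).toIntLinearMap fun x y => by
      simp [hd_mul, mul_comm], rfl⟩
  refine ⟨fun u v hu hv => ?_, fun c u hc hu => ?_, fun u hu => ?_⟩
  · simp only [iterate_map_add, mul_add, Finset.sum_add_distrib, hu, hv, add_zero]
  · simp only [D.iterate_map_const_mul hc, mul_left_comm _ c, ← Finset.mul_sum, hu, mul_zero]
  · obtain ⟨c, hDc, hc0, hsum⟩ := D.exists_constants_sum_mul_eq_zero a ha u hu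
    exact ⟨c, hDc, Function.ne_iff.mp hc0, hsum⟩
end

section
/- Let K be a differential field of characteristic 0 and let A, B ∈ M_n(K[∂]) with B non-degenerate. Then there exist A_1, B_1, D ∈ M_n(K[∂]) with B_1 and D non-degenerate, such that A = A_1 D, B = B_1 D, and ker A_1 ∩ ker B_1 = 0 (kernels taken as operators acting on K^n). -/
/-- The ring of differential operators K[∂] over a differential field (K, d),
characterized abstractly. -/
structure DiffOpRing (K : Type) [Field K] (d : K → K) (R : Type) [Ring R] where
  ι : K →+* R
  dop : R
  comm : ∀ a : K, dop * ι a = ι a * dop + ι (d a)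
  repr : ∀ r : R, ∃! c : ℕ →₀ K, r = c.sum fun i a => ι a * dop ^ i

/-- The coefficients of a differential operator. -/
noncomputable def DiffOpRing.coeff {K : Type} [Field K] {d : K → K} {R : Type} [Ring R]
    (S : DiffOpRing K d R) (r : R) : ℕ →₀ K := (S.repr r).choose

/-- The action A(f) of a differential operator A = Σ a_i ∂^i on f ∈ K. -/
noncomputable def DiffOpRing.eval {K : Type} [Field K] {d : K → K} {R : Type} [Ring R]
    (S : DiffOpRing K d R) (r : R) (f : K) : K :=
  (S.coeff r).sum fun i a => a * d^[i] f

/-- The action of a matrix differential operator on K^n. -/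
noncomputable def actM {K : Type} [Field K] {d : K → K} {R : Type} [Ring R]
    (S : DiffOpRing K d R) {n : ℕ} (A : Matrix (Fin n) (Fin n) R) (v : Fin n → K) :
    Fin n → K :=
  fun i => ∑ j, S.eval (A i j) (v j)

/-- A matrix differential operator is non-degenerate (non-zero Dieudonné determinant)
iff it has trivial right kernel over K[∂]. -/
def Nondeg {n : ℕ} {R : Type} [Ring R] (A : Matrix (Fin n) (Fin n) R) : Prop :=
  ∀ X : Fin n → R, A.mulVec X = 0 → X = 0

theorem IsPrincipalIdealRing.of_degree_reduction {T α : Type*} [Ring T] [LinearOrder α]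
    [WellFoundedLT α] (deg : T → α)
    (h : ∀ a b : T, a ≠ 0 → b ≠ 0 → deg b ≤ deg a → ∃ q, deg (a - q * b) < deg a) :
    IsPrincipalIdealRing T := by
  refine ⟨fun I => ?_⟩
  by_cases hI : ∃ b ∈ I, b ≠ 0
  · obtain ⟨b, ⟨hbI, hb⟩, hmin⟩ :=
      (InvImage.wf deg (wellFounded_lt (α := α))).has_min {b | b ∈ I ∧ b ≠ 0} hI
    have key : ∀ x : α, ∀ a ∈ I, deg a = x → a ∈ Ideal.span {b} := by
      intro x
      induction x using WellFoundedLT.induction with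
      | ind x ih =>
        intro a ha hax
        by_cases ha0 : a = 0
        · rw [ha0]; exact zero_mem _
        · obtain ⟨q, hq⟩ := h a b ha0 hb (not_lt.mp (hmin a ⟨ha, ha0⟩))
          have hmem := ih _ (hax ▸ hq) _ (I.sub_mem ha (I.mul_mem_left q hbI)) rfl
          have := add_mem hmem ((Ideal.span {b}).mul_mem_left q (Ideal.mem_span_singleton_self b))
          simpa using this
    refine ⟨b, le_antisymm (fun a ha => key _ a ha rfl) ?_⟩
    exact (Ideal.span_singleton_le_iff_mem I).mpr hbI
  · push Not at hI
    refine ⟨0, ?_⟩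
    rw [Submodule.span_zero_singleton]
    exact (Submodule.eq_bot_iff I).mpr hI

theorem Submodule.exists_fin_span_eq {T : Type*} [Ring T] [IsPrincipalIdealRing T] (n : ℕ)
    (M : Submodule T (Fin n → T)) : ∃ f : Fin n → Fin n → T, span T (Set.range f) = M := by
  induction n with
  | zero => exact ⟨Fin.elim0, Subsingleton.elim _ _⟩
  | succ n ih =>
    let head : (Fin (n + 1) → T) →ₗ[T] T := LinearMap.proj 0
    let tail : (Fin n → T) →ₗ[T] (Fin (n + 1) → T) :=
      { toFun := fun x => (Fin.cons 0 x : Fin (n + 1) → T)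
        map_add' := fun x y => by ext i; refine Fin.cases ?_ (fun i => ?_) i <;> simp
        map_smul' := fun c x => by ext i; refine Fin.cases ?_ (fun i => ?_) i <;> simp }
    obtain ⟨f, hf⟩ := ih (M.comap tail)
    obtain ⟨g, hg⟩ := (IsPrincipalIdealRing.principal (M.map head)).principal
    have hgM : g ∈ M.map head := hg ▸ mem_span_singleton_self g
    obtain ⟨m, hm, hmg⟩ := hgM
    refine ⟨Fin.cons m fun i => tail (f i), le_antisymm ?_ fun x hx => ?_⟩
    · rw [span_le, Set.range_subset_iff]
      intro i
      refine Fin.cases hm (fun i => ?_) i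
      have : f i ∈ M.comap tail := hf ▸ subset_span ⟨i, rfl⟩
      exact this
    · have hx0 : head x ∈ span T {g} := hg ▸ mem_map_of_mem hx
      obtain ⟨c, hc⟩ := mem_span_singleton.mp hx0
      have htail : tail (Fin.tail (x - c • m)) = x - c • m := by
        have h0 : (x - c • m) 0 = 0 := by
          have hc' : c * m 0 = x 0 := by rw [← hmg] at hc; exact hc
          simp [hc']
        change (Fin.cons 0 (Fin.tail (x - c • m)) : Fin (n + 1) → T) = _
        rw [← h0, Fin.cons_self_tail]
      have hy : Fin.tail (x - c • m) ∈ span T (Set.range f) := by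
        rw [hf, mem_comap, htail]
        exact M.sub_mem hx (M.smul_mem c hm)
      have hy' := mem_map_of_mem (f := tail) hy
      rw [htail, map_span, ← Set.range_comp] at hy'
      have h1 : x - c • m ∈ span T (Set.range (Fin.cons m fun i => tail (f i) :
          Fin (n + 1) → Fin (n + 1) → T)) := by
        refine span_mono ?_ hy'
        rintro _ ⟨i, rfl⟩
        exact ⟨i.succ, rfl⟩
      have h2 := smul_mem _ c (subset_span (R := T)
        (s := Set.range (Fin.cons m fun i => tail (f i) : Fin (n + 1) → Fin (n + 1) → T)) ⟨0, rfl⟩)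
      simpa using add_mem h1 h2

section Nondeg

variable {R : Type} [Ring R] {n : ℕ}

theorem Nondeg.of_mul {C D : Matrix (Fin n) (Fin n) R} (h : Nondeg (C * D)) : Nondeg D := by
  intro X hX
  apply h
  rw [← Matrix.mulVec_mulVec, hX, Matrix.mulVec_zero]

open MulOpposite in
/-- Over a right Noetherian ring, the columns of a non-degenerate matrix span a submodule of full
rank. -/
theorem Nondeg.exists_mulVec_eq [StrongRankCondition Rᵐᵒᵖ] {D : Matrix (Fin n) (Fin n) R}
    (hD : Nondeg D) (v : Fin n → R) :
    ∃ r : R, r ≠ 0 ∧ ∃ Y : Fin n → R, D.mulVec Y = fun i => v i * r := by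
  let f : (Fin (n + 1) → Rᵐᵒᵖ) →ₗ[Rᵐᵒᵖ] (Fin n → Rᵐᵒᵖ) :=
    { toFun := fun x i => op (v i * unop (x 0) + ∑ j : Fin n, D i j * unop (x j.succ))
      map_add' := fun x y => by
        ext i
        simp only [Pi.add_apply, unop_add, mul_add, Finset.sum_add_distrib, ← op_add]
        congr 1; abel
      map_smul' := fun c x => by
        ext i
        simp [mul_assoc, mul_add, Finset.mul_sum] }
  have hf : ¬ Function.Injective f := fun h => by
    have := le_of_fin_injective Rᵐᵒᵖ f h
    omega
  rw [← LinearMap.ker_eq_bot, Submodule.eq_bot_iff] at hf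
  push Not at hf
  obtain ⟨x, hx, hx0⟩ := hf
  have hx' : ∀ i, v i * unop (x 0) + ∑ j : Fin n, D i j * unop (x j.succ) = 0 := fun i =>
    op_injective (congrFun hx i)
  refine ⟨unop (x 0), fun h0 => hx0 ?_, fun j => -unop (x j.succ), ?_⟩
  · have hX := hD (fun j => unop (x j.succ)) <| by
      ext i
      simpa [h0, Matrix.mulVec, dotProduct] using hx' i
    ext i
    refine Fin.cases ?_ (fun j => ?_) i
    · exact unop_injective h0
    · exact unop_injective (congrFun hX j)
  · ext i
    simp only [Matrix.mulVec, dotProduct, mul_neg, Finset.sum_neg_distrib]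
    exact (eq_neg_of_add_eq_zero_left (hx' i)).symm

variable [NoZeroDivisors R] [StrongRankCondition Rᵐᵒᵖ] {D : Matrix (Fin n) (Fin n) R}

theorem Nondeg.left_of_mul {C : Matrix (Fin n) (Fin n) R} (hCD : Nondeg (C * D)) :
    Nondeg C := by
  intro X hX
  obtain ⟨r, hr, Y, hY⟩ := hCD.of_mul.exists_mulVec_eq X
  have hY0 : Y = 0 := by
    apply hCD
    rw [← Matrix.mulVec_mulVec, hY]
    ext i
    have := congrArg (· * r) (congrFun hX i)
    simpa [Matrix.mulVec, dotProduct, Finset.sum_mul, mul_assoc] using this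
  ext i
  have := congrFun hY i
  rw [hY0, Matrix.mulVec_zero] at this
  exact (mul_eq_zero.mp this.symm).resolve_right hr

theorem Nondeg.eq_zero_of_mul_eq_zero (hD : Nondeg D) {C : Matrix (Fin n) (Fin n) R}
    (h : C * D = 0) : C = 0 := by
  ext i j
  obtain ⟨r, hr, Y, hY⟩ := hD.exists_mulVec_eq (Pi.single j 1)
  have h1 : C.mulVec (D.mulVec Y) = 0 := by rw [Matrix.mulVec_mulVec, h, Matrix.zero_mulVec]
  have h2 := congrFun h1 i
  rw [hY] at h2
  simp only [Matrix.mulVec, dotProduct, Pi.single_apply, Pi.zero_apply] at h2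
  simp at h2
  exact h2.resolve_right hr

end Nondeg

namespace DiffOpRing

open Polynomial

variable {K : Type} [Field K] {d : K → K} {R : Type} [Ring R] (S : DiffOpRing K d R)

/-- Replacing the variable of a polynomial by `∂`, with coefficients on the left. -/
noncomputable def ofPoly : K[X] ≃+ R :=
  AddEquiv.ofBijective
    (AddMonoidHom.mk' (fun p => p.sum fun i a => S.ι a * S.dop ^ i) fun p q =>
      sum_add_index p q _ (by simp) (by simp [add_mul]))
    ⟨fun p q h => by
      have := (S.repr (p.sum fun i a => S.ι a * S.dop ^ i)).unique
        (y₁ := p.toFinsupp.coeff) (y₂ := q.toFinsupp.coeff) rfl h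
      ext i
      exact DFunLike.congr_fun this i,
    fun r => by
      obtain ⟨c, hc, -⟩ := S.repr r
      exact ⟨⟨⟨c⟩⟩, hc.symm⟩⟩

theorem ofPoly_apply (p : K[X]) : S.ofPoly p = p.sum fun i a => S.ι a * S.dop ^ i := rfl

theorem ofPoly_monomial (i : ℕ) (a : K) : S.ofPoly (monomial i a) = S.ι a * S.dop ^ i := by
  rw [ofPoly_apply, sum_monomial_index _ _ (by simp)]

theorem coeff_ofPoly (p : K[X]) : S.coeff (S.ofPoly p) = p.toFinsupp.coeff :=
  (S.repr (S.ofPoly p)).unique (S.repr (S.ofPoly p)).choose_spec.1 rfl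

theorem induction_on {P : R → Prop} (r : R) (add : ∀ r s, P r → P s → P (r + s))
    (mon : ∀ i a, P (S.ι a * S.dop ^ i)) : P r := by
  obtain ⟨p, rfl⟩ := S.ofPoly.surjective r
  induction p using Polynomial.induction_on' with
  | add p q hp hq => rw [map_add]; exact add _ _ hp hq
  | monomial i a => rw [ofPoly_monomial]; exact mon i a

/-- The operators of order less than `n`. -/
noncomputable def orderLT (n : ℕ) : AddSubgroup R :=
  (degreeLT K n).toAddSubgroup.map (S.ofPoly : K[X] →+ R)

theorem ofPoly_mem_orderLT {n : ℕ} {p : K[X]} : S.ofPoly p ∈ S.orderLT n ↔ p.degree < n := by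
  rw [← mem_degreeLT]
  exact AddSubgroup.mem_map_iff_mem S.ofPoly.injective

theorem orderLT_mono {m n : ℕ} (h : m ≤ n) : S.orderLT m ≤ S.orderLT n :=
  AddSubgroup.map_mono (degreeLT_mono h)

theorem monomial_mem_orderLT {i n : ℕ} (h : i < n) (a : K) :
    S.ι a * S.dop ^ i ∈ S.orderLT n := by
  rw [← ofPoly_monomial, ofPoly_mem_orderLT]
  exact (degree_monomial_le i a).trans_lt (by exact_mod_cast h)

theorem orderLT_induction {n : ℕ} {r : R} (hr : r ∈ S.orderLT n) {P : R → Prop}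
    (zero : P 0) (add : ∀ r s, P r → P s → P (r + s))
    (mon : ∀ i < n, ∀ a, P (S.ι a * S.dop ^ i)) : P r := by
  obtain ⟨p, hp, rfl⟩ := hr
  have hp' : p.degree < n := mem_degreeLT.mp hp
  change P (S.ofPoly p)
  rw [ofPoly_apply, Polynomial.sum_def]
  refine Finset.sum_induction _ P add zero fun i hi => mon i ?_ _
  exact_mod_cast (le_degree_of_mem_supp i hi).trans_lt hp'

theorem mul_dop_pow_mem_orderLT {n : ℕ} {r : R} (hr : r ∈ S.orderLT n) (j : ℕ) :
    r * S.dop ^ j ∈ S.orderLT (n + j) := by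
  refine S.orderLT_induction hr (P := fun r => r * S.dop ^ j ∈ S.orderLT (n + j))
    (by simp [zero_mem]) (fun r s hr hs => ?_) (fun i hi a => ?_)
  · rw [add_mul]; exact add_mem hr hs
  · rw [mul_assoc, ← pow_add]; exact S.monomial_mem_orderLT (by omega) a

theorem ι_mul_mem_orderLT {n : ℕ} {r : R} (hr : r ∈ S.orderLT n) (b : K) :
    S.ι b * r ∈ S.orderLT n := by
  refine S.orderLT_induction hr (P := fun r => S.ι b * r ∈ S.orderLT n)
    (by simp [zero_mem]) (fun r s hr hs => ?_) (fun i hi a => ?_)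
  · rw [mul_add]; exact add_mem hr hs
  · rw [← mul_assoc, ← map_mul]; exact S.monomial_mem_orderLT hi _

theorem dop_pow_mul_ι_sub_mem_orderLT (k : ℕ) (a : K) :
    S.dop ^ k * S.ι a - S.ι a * S.dop ^ k ∈ S.orderLT k := by
  induction k generalizing a with
  | zero => simp [zero_mem]
  | succ k ih =>
    have h : S.dop ^ (k + 1) * S.ι a - S.ι a * S.dop ^ (k + 1) =
        (S.dop ^ k * S.ι a - S.ι a * S.dop ^ k) * S.dop ^ 1 +
        ((S.dop ^ k * S.ι (d a) - S.ι (d a) * S.dop ^ k) + S.ι (d a) * S.dop ^ k) := by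
      rw [pow_succ, mul_assoc, S.comm]
      noncomm_ring
    rw [h]
    exact add_mem (S.mul_dop_pow_mem_orderLT (ih a) 1)
      (add_mem (S.orderLT_mono k.le_succ (ih _)) (S.monomial_mem_orderLT k.lt_succ_self _))

/-- Up to lower order terms, operators multiply like polynomials. -/
theorem ofPoly_mul_sub_mem_orderLT {m n : ℕ} {p q : K[X]} (hp : p.natDegree ≤ m)
    (hq : q.natDegree ≤ n) :
    S.ofPoly p * S.ofPoly q - S.ofPoly (p * q) ∈ S.orderLT (m + n) := by
  rw [p.as_sum_range' (m + 1) (by omega), q.as_sum_range' (n + 1) (by omega)]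
  simp only [map_sum, Finset.sum_mul_sum, ← Finset.sum_sub_distrib]
  refine sum_mem fun i hi => sum_mem fun j hj => ?_
  rw [Finset.mem_range] at hi hj
  rw [monomial_mul_monomial]
  simp only [ofPoly_monomial]
  have h : S.ι (p.coeff i) * S.dop ^ i * (S.ι (q.coeff j) * S.dop ^ j) -
      S.ι (p.coeff i * q.coeff j) * S.dop ^ (i + j) =
      S.ι (p.coeff i) * ((S.dop ^ i * S.ι (q.coeff j) - S.ι (q.coeff j) * S.dop ^ i) *
        S.dop ^ j) := by
    rw [map_mul, pow_add]
    noncomm_ring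
  rw [h]
  exact S.orderLT_mono (by omega) <| S.ι_mul_mem_orderLT
    (S.mul_dop_pow_mem_orderLT (S.dop_pow_mul_ι_sub_mem_orderLT i _) j) _

include S in
theorem noZeroDivisors : NoZeroDivisors R := by
  refine ⟨fun {a b} hab => ?_⟩
  obtain ⟨p, rfl⟩ := S.ofPoly.surjective a
  obtain ⟨q, rfl⟩ := S.ofPoly.surjective b
  by_contra! h
  have hp : p ≠ 0 := fun h0 => h.1 (by rw [h0, map_zero])
  have hq : q ≠ 0 := fun h0 => h.2 (by rw [h0, map_zero])
  have := S.ofPoly_mul_sub_mem_orderLT (le_refl p.natDegree) (le_refl q.natDegree)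
  rw [hab, zero_sub, neg_mem_iff, ofPoly_mem_orderLT, ← natDegree_mul hp hq,
    degree_eq_natDegree (mul_ne_zero hp hq)] at this
  exact lt_irrefl _ this

/-- The order of an operator, with the zero operator of order `⊥`. -/
noncomputable def order (r : R) : WithBot ℕ := (S.ofPoly.symm r).degree

theorem exists_order_sub_lt {a b : R} (ha : a ≠ 0) (hb : b ≠ 0) (h : S.order b ≤ S.order a) :
    ∃ q, S.order (a - q * b) < S.order a ∧ S.order (a - b * q) < S.order a := by
  obtain ⟨p, rfl⟩ := S.ofPoly.surjective a
  obtain ⟨s, rfl⟩ := S.ofPoly.surjective b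
  have hp : p ≠ 0 := fun h0 => ha (by rw [h0, map_zero])
  have hs : s ≠ 0 := fun h0 => hb (by rw [h0, map_zero])
  simp only [order, AddEquiv.symm_apply_apply] at h ⊢
  have hdeg : s.natDegree ≤ p.natDegree := natDegree_le_natDegree h
  have hc : p.leadingCoeff * s.leadingCoeff⁻¹ ≠ 0 := by simp [hp, hs]
  set t : K[X] := monomial (p.natDegree - s.natDegree) (p.leadingCoeff * s.leadingCoeff⁻¹) with ht
  have htdeg : t.natDegree = p.natDegree - s.natDegree := natDegree_monomial_eq _ hc
  have ht0 : t ≠ 0 := by simpa [ht] using hc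
  have hlow : (p - t * s).degree < p.degree := by
    refine degree_sub_lt_left ?_ hp ?_
    · rw [degree_eq_natDegree hp, degree_eq_natDegree (mul_ne_zero ht0 hs),
        natDegree_mul ht0 hs, htdeg, Nat.sub_add_cancel hdeg]
    · rw [leadingCoeff_mul, ht, leadingCoeff_monomial, mul_assoc,
        inv_mul_cancel₀ (leadingCoeff_ne_zero.mpr hs), mul_one]
  have key : ∀ r : R, r - S.ofPoly (t * s) ∈ S.orderLT p.natDegree →
      (S.ofPoly.symm (S.ofPoly p - r)).degree < p.degree := by
    intro r hr
    rw [degree_eq_natDegree hp, ← S.ofPoly_mem_orderLT, AddEquiv.apply_symm_apply]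
    have h1 : S.ofPoly (p - t * s) ∈ S.orderLT p.natDegree := by
      rwa [ofPoly_mem_orderLT, ← degree_eq_natDegree hp]
    have := sub_mem h1 hr
    rwa [map_sub, sub_sub_sub_cancel_right] at this
  refine ⟨S.ofPoly t, key _ ?_, key _ ?_⟩
  · have := S.ofPoly_mul_sub_mem_orderLT htdeg.le (le_refl s.natDegree)
    rwa [Nat.sub_add_cancel hdeg] at this
  · have := S.ofPoly_mul_sub_mem_orderLT (le_refl s.natDegree) htdeg.le
    rwa [Nat.add_sub_cancel' hdeg, mul_comm s t] at this

include S in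
theorem isPrincipalIdealRing : IsPrincipalIdealRing R :=
  .of_degree_reduction S.order fun _ _ ha hb h =>
    (S.exists_order_sub_lt ha hb h).imp fun _ hq => hq.1

include S in
theorem isPrincipalIdealRing_op : IsPrincipalIdealRing Rᵐᵒᵖ :=
  .of_degree_reduction (fun r => S.order r.unop) fun a b ha hb h => by
    obtain ⟨q, -, hq⟩ := S.exists_order_sub_lt
      (MulOpposite.unop_ne_zero_iff a |>.mpr ha) (MulOpposite.unop_ne_zero_iff b |>.mpr hb) h
    exact ⟨MulOpposite.op q, hq⟩

include S in
theorem nontrivial : Nontrivial R := S.ofPoly.symm.toEquiv.nontrivial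

theorem eval_eq_sum (p : K[X]) (f : K) :
    S.eval (S.ofPoly p) f = p.sum fun i a => a * d^[i] f := by
  rw [eval, coeff_ofPoly]; rfl

theorem eval_monomial (i : ℕ) (a f : K) : S.eval (S.ι a * S.dop ^ i) f = a * d^[i] f := by
  rw [← ofPoly_monomial, eval_eq_sum, sum_monomial_index _ _ (by simp)]

theorem eval_add_left (r s : R) (f : K) : S.eval (r + s) f = S.eval r f + S.eval s f := by
  obtain ⟨p, rfl⟩ := S.ofPoly.surjective r
  obtain ⟨q, rfl⟩ := S.ofPoly.surjective s
  rw [← map_add]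
  simp only [eval_eq_sum]
  exact sum_add_index p q _ (by simp) (by simp [add_mul])

theorem eval_sum_left {α : Type*} (s : Finset α) (r : α → R) (f : K) :
    S.eval (∑ i ∈ s, r i) f = ∑ i ∈ s, S.eval (r i) f :=
  map_sum (AddMonoidHom.mk' (S.eval · f) fun r s => S.eval_add_left r s f) r s

theorem eval_one (f : K) : S.eval 1 f = f := by
  simpa using S.eval_monomial 0 1 f

theorem eval_zero_left (f : K) : S.eval 0 f = 0 := by
  simpa using S.eval_monomial 0 0 f

theorem eval_ι_mul (a : K) (r : R) (f : K) : S.eval (S.ι a * r) f = a * S.eval r f := by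
  induction r using S.induction_on with
  | add r s hr hs => rw [mul_add, eval_add_left, eval_add_left, hr, hs, mul_add]
  | mon i b => rw [← mul_assoc, ← map_mul, eval_monomial, eval_monomial, mul_assoc]

section Derivation

variable (hd_add : ∀ a b : K, d (a + b) = d a + d b)
include hd_add

theorem eval_add_right (r : R) (f g : K) : S.eval r (f + g) = S.eval r f + S.eval r g := by
  induction r using S.induction_on with
  | add r s hr hs => simp only [eval_add_left, hr, hs]; abel
  | mon i a =>
    have h : d^[i] (f + g) = d^[i] f + d^[i] g := by
      induction i with
      | zero => rfl
      | succ i ih => simp only [Function.iterate_succ_apply', ih, hd_add]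
    simp only [eval_monomial, h, mul_add]

theorem eval_sum_right {α : Type*} (r : R) (s : Finset α) (f : α → K) :
    S.eval r (∑ i ∈ s, f i) = ∑ i ∈ s, S.eval r (f i) :=
  map_sum (AddMonoidHom.mk' (S.eval r) (S.eval_add_right hd_add r)) f s

variable (hd_mul : ∀ a b : K, d (a * b) = a * d b + d a * b)
include hd_mul

theorem eval_dop_mul (r : R) (f : K) : S.eval (S.dop * r) f = d (S.eval r f) := by
  induction r using S.induction_on with
  | add r s hr hs => rw [mul_add, eval_add_left, eval_add_left, hr, hs, hd_add]
  | mon i b =>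
    rw [← mul_assoc, S.comm, add_mul, mul_assoc, ← pow_succ', eval_add_left]
    simp only [eval_monomial, hd_mul, Function.iterate_succ_apply']

theorem eval_mul (r s : R) (f : K) : S.eval (r * s) f = S.eval r (S.eval s f) := by
  induction r using S.induction_on with
  | add r t hr ht => rw [add_mul, eval_add_left, eval_add_left, hr, ht]
  | mon i a =>
    rw [mul_assoc, eval_ι_mul, eval_monomial]
    congr 1
    induction i with
    | zero => simp
    | succ i ih => rw [pow_succ', mul_assoc, S.eval_dop_mul hd_add hd_mul, ih,
        Function.iterate_succ_apply']

theorem actM_mul {n : ℕ} (A B : Matrix (Fin n) (Fin n) R) (v : Fin n → K) :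
    actM S (A * B) v = actM S A (actM S B v) := by
  ext i
  simp only [actM, Matrix.mul_apply, eval_sum_left, S.eval_sum_right hd_add,
    S.eval_mul hd_add hd_mul]
  exact Finset.sum_comm

end Derivation

theorem actM_add {n : ℕ} (A B : Matrix (Fin n) (Fin n) R) (v : Fin n → K) :
    actM S (A + B) v = actM S A v + actM S B v := by
  ext i
  simp [actM, eval_add_left, Finset.sum_add_distrib]

theorem actM_one {n : ℕ} (v : Fin n → K) :
    actM S (1 : Matrix (Fin n) (Fin n) R) v = v := by
  ext i
  rw [actM, Finset.sum_eq_single i]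
  · rw [Matrix.one_apply_eq, eval_one]
  · intro j _ hj
    rw [Matrix.one_apply_ne hj.symm, eval_zero_left]
  · simp

theorem actM_apply_zero (hd_add : ∀ a b : K, d (a + b) = d a + d b) {n : ℕ}
    (A : Matrix (Fin n) (Fin n) R) : actM S A 0 = 0 := by
  ext i
  simp [actM, show ∀ r : R, S.eval r 0 = 0 from fun r => by
    simpa using S.eval_add_right hd_add r 0 0]

end DiffOpRing

/-- Over a left principal ideal ring, any two square matrices have a greatest common right divisor,
and it is a left linear combination of them. -/
theorem Matrix.exists_right_gcd {T : Type*} [Ring T] [IsPrincipalIdealRing T] {n : ℕ}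
    (A B : Matrix (Fin n) (Fin n) T) :
    ∃ A₁ B₁ D U V : Matrix (Fin n) (Fin n) T, A = A₁ * D ∧ B = B₁ * D ∧ D = U * A + V * B := by
  obtain ⟨D, hD⟩ := Submodule.exists_fin_span_eq n
    (Submodule.span T (Set.range A) ⊔ Submodule.span T (Set.range B))
  have hA : ∀ i, ∃ c : Fin n → T, ∑ j, c j • D j = A i := fun i =>
    (Submodule.mem_span_range_iff_exists_fun T).mp <|
      hD ▸ Submodule.mem_sup_left (Submodule.subset_span ⟨i, rfl⟩)
  have hB : ∀ i, ∃ c : Fin n → T, ∑ j, c j • D j = B i := fun i =>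
    (Submodule.mem_span_range_iff_exists_fun T).mp <|
      hD ▸ Submodule.mem_sup_right (Submodule.subset_span ⟨i, rfl⟩)
  have hUV : ∀ i, ∃ u v : Fin n → T, ∑ j, u j • A j + ∑ j, v j • B j = D i := fun i => by
    have hi : D i ∈ Submodule.span T (Set.range A) ⊔ Submodule.span T (Set.range B) :=
      hD ▸ Submodule.subset_span ⟨i, rfl⟩
    obtain ⟨y, hy, z, hz, hyz⟩ := Submodule.mem_sup.mp hi
    obtain ⟨u, rfl⟩ := (Submodule.mem_span_range_iff_exists_fun T).mp hy
    obtain ⟨v, rfl⟩ := (Submodule.mem_span_range_iff_exists_fun T).mp hz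
    exact ⟨u, v, hyz⟩
  choose A₁ hA₁ using hA
  choose B₁ hB₁ using hB
  choose U V hUV using hUV
  refine ⟨of A₁, of B₁, of D, of U, of V, ?_, ?_, ?_⟩
  · ext i k
    simpa [mul_apply] using (congrFun (hA₁ i) k).symm
  · ext i k
    simpa [mul_apply] using (congrFun (hB₁ i) k).symm
  · ext i k
    simpa [mul_apply] using (congrFun (hUV i) k).symm

/-- Let K be a differential field of characteristic 0 and A, B ∈
M_n(K[∂]) with B non-degenerate. Then there exist A₁, B₁, D ∈ M_n(K[∂]) with B₁ and D
non-degenerate, such that A = A₁D, B = B₁D, and ker A₁ ∩ ker B₁ = 0 in K^n. -/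
theorem stmt_12 (K : Type) [Field K] [CharZero K] (d : K → K)
    (hd_add : ∀ a b : K, d (a + b) = d a + d b)
    (hd_mul : ∀ a b : K, d (a * b) = a * d b + d a * b)
    (R : Type) [Ring R] (S : DiffOpRing K d R)
    (n : ℕ) (A B : Matrix (Fin n) (Fin n) R) (hB : Nondeg B) :
    ∃ A₁ B₁ D : Matrix (Fin n) (Fin n) R,
      Nondeg B₁ ∧ Nondeg D ∧ A = A₁ * D ∧ B = B₁ * D ∧
      ∀ v : Fin n → K, actM S A₁ v = 0 → actM S B₁ v = 0 → v = 0 := by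
  have := S.nontrivial
  have := S.noZeroDivisors
  have := S.isPrincipalIdealRing
  have := S.isPrincipalIdealRing_op
  obtain ⟨A₁, B₁, D, U, V, hA, hB₁, hD⟩ := Matrix.exists_right_gcd A B
  have hBD : Nondeg (B₁ * D) := hB₁ ▸ hB
  have hUV : U * A₁ + V * B₁ = 1 := by
    refine sub_eq_zero.mp (hBD.of_mul.eq_zero_of_mul_eq_zero ?_)
    rw [sub_mul, add_mul, mul_assoc, mul_assoc, ← hA, ← hB₁, ← hD, one_mul, sub_self]
  refine ⟨A₁, B₁, D, hBD.left_of_mul, hBD.of_mul, hA, hB₁, fun v hvA hvB => ?_⟩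
  rw [← S.actM_one v, ← hUV, S.actM_add, S.actM_mul hd_add hd_mul, S.actM_mul hd_add hd_mul,
    hvA, hvB, S.actM_apply_zero hd_add, S.actM_apply_zero hd_add, add_zero]
end
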